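/- Let (V,g) be a 2n-dimensional real inner product space with a fixed orthogonal complex structure J, and let m₁, m₋₁ be nonnegative integers. There exists an orthogonal complex structure K on V with dim ker(J+K) = 2m₁ and dim ker(J-K) = 2m₋₁ if and only if n - m₁ - m₋₁ is a nonnegative even integer. -/

import Mathlib

open Module

/-- The complex vector space structure on a real vector space in which `I` acts by `J`. -/
abbrev moduleComplexOfSqEqNegOne {V : Type*} [AddCommGroup V] [Module ℝ V] (J : End ℝ V)
    (hJ : J * J = -1) : Module ℂ V :=
  Module.compHom V (Complex.liftAux J hJ).toRingHom

/-- The Hermitian inner product space structure on a real inner product space with an orthogonal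
complex structure `J`, in which `I` acts by `J`. -/
noncomputable abbrev innerProductSpaceComplexOfSqEqNegOne {V : Type*} [NormedAddCommGroup V]
    [InnerProductSpace ℝ V] (J : End ℝ V) (hJ : J * J = -1)
    (hJg : ∀ v w : V, inner ℝ (J v) (J w) = inner ℝ v w) : InnerProductSpace ℂ V :=
  letI := moduleComplexOfSqEqNegOne J hJ
  have smul_def (z : ℂ) (v : V) : z • v = z.re • v + z.im • J v := by
    change (Complex.liftAux J hJ z) v = _
    simp [Complex.liftAux_apply]
  have hJJ (v : V) : J (J v) = -v := by simpa using LinearMap.congr_fun hJ v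
  have skew (v w : V) : inner ℝ (J v) w = -inner ℝ v (J w) := by
    rw [← hJg v, hJJ, inner_neg_right, neg_neg]
  have self (v : V) : inner ℝ v (J v) = 0 := by
    have := skew v v
    rw [real_inner_comm] at this
    linarith
  have norm_J (v : V) : ‖J v‖ = ‖v‖ := by
    rw [norm_eq_sqrt_real_inner, hJg, ← norm_eq_sqrt_real_inner]
  { smul := fun z v => z • v
    one_smul := one_smul ℂ
    mul_smul := mul_smul
    smul_zero := smul_zero
    smul_add := smul_add
    add_smul := add_smul
    zero_smul := zero_smul ℂ
    norm_smul_le := fun z v => by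
      have : ‖z • v‖ ^ 2 = (‖z‖ * ‖v‖) ^ 2 := by
        rw [smul_def, norm_add_sq_real, mul_pow, Complex.sq_norm, Complex.normSq_apply]
        simp only [norm_smul, inner_smul_left, inner_smul_right, norm_J, self]
        simp [mul_pow]
        ring
      exact (pow_le_pow_iff_left₀ (norm_nonneg _) (by positivity) two_ne_zero).1 this.le
    inner := fun v w => ⟨inner ℝ v w, inner ℝ (J v) w⟩
    norm_sq_eq_re_inner := fun v => (real_inner_self_eq_norm_sq v).symm
    conj_inner_symm := fun v w => by
      apply Complex.ext
      · exact real_inner_comm _ _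
      · simp [skew w v, real_inner_comm]
    add_left := fun u v w => by
      apply Complex.ext <;> simp [inner_add_left]
    smul_left := fun v w z => by
      apply Complex.ext <;> simp [smul_def, inner_add_left, inner_smul_left, hJJ] }


/-- A nondegenerate skew-symmetric form in characteristic not two lives in even dimension. -/
theorem LinearMap.BilinForm.even_finrank_of_neg_swap_of_nondegenerate {K V : Type*} [Field K]
    [NeZero (2 : K)] [AddCommGroup V] [Module K V] [FiniteDimensional K V]
    {B : LinearMap.BilinForm K V} (hB : ∀ v w, B v w = -B w v) (hB' : B.Nondegenerate) :
    Even (finrank K V) := by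
  let b := finBasis K V
  set M := BilinForm.toMatrix b B with hM
  have hdet : M.det ≠ 0 := (BilinForm.nondegenerate_iff_det_ne_zero b).1 hB'
  have hMt : M.transpose = -M := by
    ext i j
    simp [hM, BilinForm.toMatrix_apply, hB (b j) (b i)]
  have h : M.det = (-1) ^ finrank K V * M.det := by
    conv_lhs => rw [← Matrix.det_transpose, hMt, Matrix.det_neg, Fintype.card_fin]
  by_contra hodd
  rw [(Nat.not_even_iff_odd.1 hodd).neg_one_pow] at h
  have h2 : (2 : K) * M.det = 0 := by linear_combination h
  exact (mul_ne_zero two_ne_zero hdet) h2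

/-- Unitary coordinates on a real inner product space with an orthogonal complex structure. -/
theorem exists_linearEquiv_pi_complex_of_sq_eq_neg_one
    {V : Type*} [NormedAddCommGroup V] [InnerProductSpace ℝ V]
    [FiniteDimensional ℝ V]
    {ι : Type*} [Fintype ι] (hdim : finrank ℝ V = 2 * Fintype.card ι)
    (J : End ℝ V) (hJ : J * J = -1)
    (hJg : ∀ v w : V, inner ℝ (J v) (J w) = inner ℝ v w) :
    ∃ φ : V ≃ₗ[ℝ] (ι → ℂ), (∀ v i, φ (J v) i = Complex.I * φ v i) ∧
      ∀ v w, inner ℝ v w = ∑ i, (star (φ v i) * φ w i).re := by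
  let := innerProductSpaceComplexOfSqEqNegOne J hJ hJg
  have smul_def (z : ℂ) (v : V) : z • v = z.re • v + z.im • J v := by
    change (Complex.liftAux J hJ z) v = _
    simp [Complex.liftAux_apply]
  have : IsScalarTower ℝ ℂ V := ⟨fun r z v => by simp [smul_def, smul_smul]⟩
  have : FiniteDimensional ℂ V := FiniteDimensional.right ℝ ℂ V
  have hcard : finrank ℂ V = Fintype.card ι := by
    have := finrank_mul_finrank ℝ ℂ V
    rw [Complex.finrank_real_complex, hdim] at this
    omega
  let b := (stdOrthonormalBasis ℂ V).reindex (Fintype.equivOfCardEq (by simpa using hcard))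
  refine ⟨(b.toBasis.equivFun).restrictScalars ℝ, fun v i => ?_, fun v w => ?_⟩
  · have : J v = Complex.I • v := by simp [smul_def]
    simp [this]
  · have h1 : inner ℝ v w = (inner ℂ v w).re := rfl
    rw [h1, ← b.repr.inner_map_map, PiLp.inner_apply, Complex.re_sum]
    simp [mul_comm]

/-- If an injective skew-adjoint map anticommutes with an orthogonal complex structure, the real
dimension is divisible by four. -/
theorem exists_finrank_eq_four_mul_of_anticommute
    {V : Type*} [NormedAddCommGroup V] [InnerProductSpace ℝ V]
    [FiniteDimensional ℝ V] (J C : End ℝ V)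
    (hJ : J * J = -1) (hJg : ∀ v w : V, inner ℝ (J v) (J w) = inner ℝ v w)
    (hJC : J * C = -(C * J)) (hC : ∀ v w : V, inner ℝ (C v) w = -inner ℝ v (C w))
    (hker : ∀ v, C v = 0 → v = 0) : ∃ k, finrank ℝ V = 4 * k := by
  let := innerProductSpaceComplexOfSqEqNegOne J hJ hJg
  have smul_def (z : ℂ) (v : V) : z • v = z.re • v + z.im • J v := by
    change (Complex.liftAux J hJ z) v = _
    simp [Complex.liftAux_apply]
  have : IsScalarTower ℝ ℂ V := ⟨fun r z v => by simp [smul_def, smul_smul]⟩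
  have : FiniteDimensional ℂ V := FiniteDimensional.right ℝ ℂ V
  have hJJ (v : V) : J (J v) = -v := by simpa using LinearMap.congr_fun hJ v
  have hJC' (v : V) : J (C v) = -C (J v) := by simpa using LinearMap.congr_fun hJC v
  have skew (v w : V) : inner ℝ (J v) w = -inner ℝ v (J w) := by
    rw [← hJg v, hJJ, inner_neg_right, neg_neg]
  have hCsmul (z : ℂ) (v : V) : C (z • v) = star z • C v := by
    simp [smul_def, hJC']
  let B : LinearMap.BilinForm ℂ V := LinearMap.mk₂ ℂ (fun v w => inner ℂ (C v) w)
    (by simp) (by simp [hCsmul, mul_comm]) (by simp) (by simp)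
  have hB (v w : V) : B v w = -B w v := by
    change (⟨inner ℝ (C v) w, inner ℝ (J (C v)) w⟩ : ℂ) =
      -⟨inner ℝ (C w) v, inner ℝ (J (C w)) v⟩
    apply Complex.ext
    · simp [hC v, real_inner_comm]
    · simp [hJC' v, hC (J v), skew, real_inner_comm]
  have hleft (v : V) (h : ∀ w, B v w = 0) : v = 0 := hker v (inner_self_eq_zero.1 (h (C v)))
  have hnd : B.Nondegenerate :=
    ⟨hleft, fun v h => hleft v fun w => by rw [hB, h, neg_zero]⟩
  obtain ⟨k, hk⟩ := LinearMap.BilinForm.even_finrank_of_neg_swap_of_nondegenerate hB hnd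
  refine ⟨k, ?_⟩
  rw [← finrank_mul_finrank ℝ ℂ V, Complex.finrank_real_complex, hk]
  ring

theorem ker_mul_sub_mul_eq_sup {V : Type*} [AddCommGroup V] [Module ℝ V] {J K : End ℝ V}
    (hJ : J * J = -1) (hK : K * K = -1) :
    LinearMap.ker (J * K - K * J) = LinearMap.ker (J + K) ⊔ LinearMap.ker (J - K) := by
  have hJJ (v : V) : J (J v) = -v := by simpa using LinearMap.congr_fun hJ v
  have hKK (v : V) : K (K v) = -v := by simpa using LinearMap.congr_fun hK v
  apply le_antisymm
  · intro v hv
    have hv : J (K v) = K (J v) := by simpa [sub_eq_zero] using hv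
    refine Submodule.mem_sup.2 ⟨(2⁻¹ : ℝ) • (v + J (K v)), ?_, (2⁻¹ : ℝ) • (v - J (K v)), ?_, ?_⟩
    · simp [hv, hKK]
      simp [← hv, hJJ]
    · simp [hv, hKK]
      simp [← hv, hJJ]
      abel
    · module
  · refine sup_le (fun v hv => ?_) fun v hv => ?_
    · have hv : J v = -K v := by simpa [add_eq_zero_iff_eq_neg] using hv
      have hv' : K v = -J v := by rw [hv, neg_neg]
      rw [LinearMap.mem_ker, LinearMap.sub_apply, Module.End.mul_apply, Module.End.mul_apply, hv',
        map_neg, hJJ, hv, map_neg, hKK, sub_self]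
    · have hv : J v = K v := by simpa [sub_eq_zero] using hv
      rw [LinearMap.mem_ker, LinearMap.sub_apply, Module.End.mul_apply, Module.End.mul_apply, ← hv,
        hJJ, hv, hKK, sub_self]

theorem disjoint_ker_add_ker_sub {V : Type*} [AddCommGroup V] [Module ℝ V] {J K : End ℝ V}
    (hJ : J * J = -1) : Disjoint (LinearMap.ker (J + K)) (LinearMap.ker (J - K)) := by
  refine Submodule.disjoint_def.2 fun v h1 h2 => ?_
  have h1 : J v + K v = 0 := h1
  have h2 : J v - K v = 0 := h2
  have h3 : J v = 0 := by
    rw [show J v = (2⁻¹ : ℝ) • ((J v + K v) + (J v - K v)) by module, h1, h2, add_zero, smul_zero]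
  have : J (J v) = -v := by simpa using LinearMap.congr_fun hJ v
  simpa [h3] using this

theorem exists_finrank_eq_ker_add_ker_add
    {V : Type*} [NormedAddCommGroup V] [InnerProductSpace ℝ V]
    [FiniteDimensional ℝ V] (J K : End ℝ V)
    (hJ : J * J = -1) (hJg : ∀ v w : V, inner ℝ (J v) (J w) = inner ℝ v w)
    (hK : K * K = -1) (hKg : ∀ v w : V, inner ℝ (K v) (K w) = inner ℝ v w) :
    ∃ k, finrank ℝ V =
      finrank ℝ (LinearMap.ker (J + K)) + finrank ℝ (LinearMap.ker (J - K)) + 4 * k := by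
  have hJJ (v : V) : J (J v) = -v := by simpa using LinearMap.congr_fun hJ v
  have hKK (v : V) : K (K v) = -v := by simpa using LinearMap.congr_fun hK v
  have skewJ (v w : V) : inner ℝ (J v) w = -inner ℝ v (J w) := by
    rw [← hJg v, hJJ, inner_neg_right, neg_neg]
  have skewK (v w : V) : inner ℝ (K v) w = -inner ℝ v (K w) := by
    rw [← hKg v, hKK, inner_neg_right, neg_neg]
  set C : End ℝ V := J * K - K * J with hCdef
  have hCv (v : V) : C v = J (K v) - K (J v) := rfl
  have hJC (v : V) : J (C v) = -C (J v) := by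
    simp [hCv, hJJ, sub_eq_add_neg]
  have skewC (v w : V) : inner ℝ (C v) w = -inner ℝ v (C w) := by
    simp [hCv, inner_sub_left, inner_sub_right, skewJ, skewK]
  set W := (LinearMap.ker C)ᗮ
  have hJW : ∀ v ∈ W, J v ∈ W := fun v hv u hu => by
    have hJu : J u ∈ LinearMap.ker C := by
      have := hJC u
      rw [LinearMap.mem_ker.1 hu, map_zero, eq_comm, neg_eq_zero] at this
      exact this
    have := hv _ hJu
    rw [skewJ] at this
    simpa using this
  have hCW : ∀ v ∈ W, C v ∈ W := fun v _ u hu => by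
    have := skewC u v
    rw [LinearMap.mem_ker.1 hu, inner_zero_left] at this
    linarith
  obtain ⟨k, hk⟩ := exists_finrank_eq_four_mul_of_anticommute (J.restrict hJW) (C.restrict hCW)
    (by ext v; simp [hJJ]) (fun v w => hJg v w) (by ext v; simp [hJC]) (fun v w => skewC v w)
    (fun v hv => by
      have h0 : C v = 0 := congrArg Subtype.val hv
      have := v.2 v h0
      simpa using this)
  refine ⟨k, ?_⟩
  have h := Submodule.finrank_sup_add_finrank_inf_eq (LinearMap.ker (J + K)) (LinearMap.ker (J - K))
  rw [(disjoint_ker_add_ker_sub hJ).eq_bot, finrank_bot, add_zero] at h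
  rw [← (LinearMap.ker C).finrank_add_finrank_orthogonal, hk, hCdef, ker_mul_sub_mul_eq_sup hJ hK, h]

theorem finrank_eq_of_mem_iff_coord_eq_zero {V ι κ : Type*} [AddCommGroup V] [Module ℝ V]
    [Fintype κ] (φ : V ≃ₗ[ℝ] (ι → ℂ)) {e : κ → ι} (he : Function.Injective e) {W : Submodule ℝ V}
    (hW : ∀ v, v ∈ W ↔ ∀ i ∉ Set.range e, φ v i = 0) :
    finrank ℝ W = 2 * Fintype.card κ := by
  let ψ : (κ → ℂ) →ₗ[ℝ] V :=
    φ.symm.toLinearMap ∘ₗ (Function.ExtendByZero.linearMap ℂ e).restrictScalars ℝ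
  have hφψ (a : κ → ℂ) : φ (ψ a) = Function.extend e a 0 := φ.apply_symm_apply _
  have hψ : Function.Injective ψ := fun a b hab => by
    have := congrArg φ hab
    rw [hφψ, hφψ] at this
    exact Function.extend_injective he (0 : ι → ℂ) this
  have hrange : LinearMap.range ψ = W := by
    ext v
    rw [LinearMap.mem_range, hW]
    constructor
    · rintro ⟨a, rfl⟩ i hi
      rw [hφψ, Function.extend_apply' _ _ _ hi, Pi.zero_apply]
    · intro h
      refine ⟨φ v ∘ e, φ.injective (funext fun i => ?_)⟩
      rw [hφψ]
      by_cases hi : i ∈ Set.range e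
      · obtain ⟨j, rfl⟩ := hi
        exact he.extend_apply _ _ _
      · rw [Function.extend_apply' _ _ _ hi, h i hi, Pi.zero_apply]
  rw [← hrange, LinearMap.finrank_range_of_inj hψ]
  simp [finrank_pi_fintype, mul_comm]

open Complex in
theorem exists_orthogonal_complex_structure_with_kernel_dims
    {V : Type*} [NormedAddCommGroup V] [InnerProductSpace ℝ V]
    [FiniteDimensional ℝ V] (p q k : ℕ)
    (hdim : finrank ℝ V = 2 * (p + q + 2 * k)) (J : End ℝ V) (hJ : J * J = -1)
    (hJg : ∀ v w : V, inner ℝ (J v) (J w) = inner ℝ v w) :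
    ∃ K : End ℝ V, K * K = -1 ∧ (∀ v w : V, inner ℝ (K v) (K w) = inner ℝ v w) ∧
      finrank ℝ (LinearMap.ker (J + K)) = 2 * p ∧ finrank ℝ (LinearMap.ker (J - K)) = 2 * q := by
  let ι := Fin p ⊕ Fin q ⊕ Fin k ⊕ Fin k
  obtain ⟨φ, hφJ, hφ⟩ := exists_linearEquiv_pi_complex_of_sq_eq_neg_one (ι := ι)
    (by rw [hdim]; simp [ι]; ring) J hJ hJg
  let L : End ℝ (ι → ℂ) :=
    { toFun := fun z => Sum.elim (fun i => -(I * z (.inl i))) <| Sum.elim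
        (fun i => I * z (.inr (.inl i))) <| Sum.elim
        (fun i => -star (z (.inr (.inr (.inr i))))) (fun i => star (z (.inr (.inr (.inl i)))))
      map_add' := fun x y => by
        ext (i | i | i | i) <;> simp [mul_add, add_comm]
      map_smul' := fun r x => by
        ext (i | i | i | i) <;> simp [mul_left_comm] }
  let K : End ℝ V := φ.symm.conj L
  have hφK (v : V) : φ (K v) = L (φ v) := by simp [K, LinearEquiv.conj_apply]
  refine ⟨K, ?_, fun v w => ?_, ?_, ?_⟩
  · ext v
    apply φ.injective
    ext (i | i | i | i) <;> simp [hφK, L, ← mul_assoc]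
  · rw [hφ, hφ, hφK, hφK]
    simp only [ι, Fintype.sum_sum_type]
    congr 1
    · simp [L]
    · congr 1
      · simp [L]
      · rw [add_comm]
        simp [L]
  · rw [finrank_eq_of_mem_iff_coord_eq_zero φ (e := .inl) Sum.inl_injective fun v => ?_,
      Fintype.card_fin]
    rw [LinearMap.mem_ker, ← φ.map_eq_zero_iff, funext_iff]
    simp only [LinearMap.add_apply, map_add, Pi.add_apply, hφJ, hφK]
    simp [ι, L]
    rintro -
    rw [← forall_and, ← forall_and]
    refine forall_congr' fun i => ?_
    simp only [Complex.ext_iff]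
    simp
    grind
  · rw [finrank_eq_of_mem_iff_coord_eq_zero φ (e := .inr ∘ .inl)
      (Sum.inr_injective.comp Sum.inl_injective) fun v => ?_, Fintype.card_fin]
    rw [LinearMap.mem_ker, ← φ.map_eq_zero_iff, funext_iff]
    simp only [LinearMap.sub_apply, map_sub, Pi.sub_apply, hφJ, hφK]
    simp [ι, L]
    rintro -
    rw [← forall_and, ← forall_and]
    refine forall_congr' fun i => ?_
    simp only [Complex.ext_iff]
    simp
    grind

/-- On a `2n`-dimensional real inner product space with a fixed orthogonal
complex structure `J`, there exists an orthogonal complex structure `K` with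
`dim ker (J+K) = 2m₁` and `dim ker (J-K) = 2mneg` if and only if `n - m₁ - mneg` is a
nonnegative even integer. -/
theorem exists_orthogonal_complex_structure_with_kernel_dims_iff
    (V : Type*) [NormedAddCommGroup V] [InnerProductSpace ℝ V] [FiniteDimensional ℝ V]
    (n m₁ mneg : ℕ) (hdim : Module.finrank ℝ V = 2 * n)
    (J : Module.End ℝ V) (hJ : J * J = -1)
    (hJg : ∀ v w : V, @inner ℝ V _ (J v) (J w) = @inner ℝ V _ v w) :
    (∃ K : Module.End ℝ V, K * K = -1 ∧
        (∀ v w : V, @inner ℝ V _ (K v) (K w) = @inner ℝ V _ v w) ∧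
        Module.finrank ℝ (LinearMap.ker (J + K)) = 2 * m₁ ∧
        Module.finrank ℝ (LinearMap.ker (J - K)) = 2 * mneg) ↔
      ∃ k : ℕ, n = m₁ + mneg + 2 * k := by
  constructor
  · rintro ⟨K, hK, hKg, h1, h2⟩
    obtain ⟨k, hk⟩ := exists_finrank_eq_ker_add_ker_add J K hJ hJg hK hKg
    exact ⟨k, by omega⟩
  · rintro ⟨k, rfl⟩
    exact exists_orthogonal_complex_structure_with_kernel_dims m₁ mneg k hdim J hJ hJg
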